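/- For every integer k ≥ 3, the prefix of length 4k of the Thue–Morse word is a shuffle square; that is, the binary word (t(0), t(1), …, t(4k−1)), where t(n) is the parity (0 or 1) of the number of ones in the binary representation of n, is a shuffle square. -/

import Mathlib

/-- `Interleave x y z` means that `z` is an interleaving (shuffle) of the words
`x` and `y`. -/
inductive Interleave {α : Type*} : List α → List α → List α → Prop
  | nil : Interleave [] [] []
  | cons_left (a : α) {xs ys zs : List α} :
      Interleave xs ys zs → Interleave (a :: xs) ys (a :: zs)
  | cons_right (a : α) {xs ys zs : List α} :
      Interleave xs ys zs → Interleave xs (a :: ys) (a :: zs)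

/-- A word is a shuffle square if it is an interleaving of two copies of the same word. -/
def IsShuffleSquare {α : Type*} (w : List α) : Prop :=
  ∃ x : List α, Interleave x x w

/-- The `n`-th letter of the Thue–Morse word: the parity of the number of ones in the
binary representation of `n` (`true` encodes `1`). -/
def thueMorse (n : ℕ) : Bool :=
  (Nat.digits 2 n).sum % 2 == 1

theorem Interleave.append {α : Type*} {x y z x' y' z' : List α} (h : Interleave x y z)
    (h' : Interleave x' y' z') : Interleave (x ++ x') (y ++ y') (z ++ z') := by
  induction h with
  | nil => exact h'
  | cons_left a _ ih => exact ih.cons_left a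
  | cons_right a _ ih => exact ih.cons_right a

theorem IsShuffleSquare.append {α : Type*} {v w : List α} (hv : IsShuffleSquare v)
    (hw : IsShuffleSquare w) : IsShuffleSquare (v ++ w) := by
  obtain ⟨x, hx⟩ := hv
  obtain ⟨y, hy⟩ := hw
  exact ⟨x ++ y, hx.append hy⟩

/-- Searches for a way to read `w` that empties the queue `q`, where each letter of `w` is either
appended to the back of the queue or cancelled against an equal letter at its front. -/
def queueEmpties : List Bool → List Bool → Bool
  | q, [] => q.isEmpty
  | [], c :: w => queueEmpties [c] w
  | a :: q, c :: w => (a == c && queueEmpties q w) || queueEmpties (a :: q ++ [c]) w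

theorem exists_interleave_of_queueEmpties (q w : List Bool) (h : queueEmpties q w = true) :
    ∃ y, Interleave y (q ++ y) w := by
  induction w generalizing q with
  | nil =>
    cases q with
    | nil => exact ⟨[], .nil⟩
    | cons a q => simp [queueEmpties] at h
  | cons c w ih =>
    have push (q : List Bool) (h : queueEmpties (q ++ [c]) w = true) :
        ∃ y, Interleave y (q ++ y) (c :: w) := by
      obtain ⟨y, hy⟩ := ih _ h
      exact ⟨c :: y, .cons_left c (by simpa using hy)⟩
    cases q with
    | nil => exact push [] h
    | cons a q =>
      simp only [queueEmpties, Bool.or_eq_true, Bool.and_eq_true, beq_iff_eq] at h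
      obtain ⟨rfl, h⟩ | h := h
      · obtain ⟨y, hy⟩ := ih _ h
        exact ⟨y, .cons_right a hy⟩
      · exact push (a :: q) h

theorem isShuffleSquare_of_queueEmpties {w : List Bool} (h : queueEmpties [] w = true) :
    IsShuffleSquare w :=
  exists_interleave_of_queueEmpties [] w h

theorem thueMorse_two_mul (n : ℕ) : thueMorse (2 * n) = thueMorse n := by
  obtain rfl | hn := Nat.eq_zero_or_pos n
  · rfl
  · simp [thueMorse, Nat.digits_def' one_lt_two (show 0 < 2 * n by omega)]

theorem thueMorse_two_mul_add_one (n : ℕ) : thueMorse (2 * n + 1) = !thueMorse n := by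
  have h : (2 * n + 1) / 2 = n := by omega
  simp only [thueMorse, Nat.digits_def' one_lt_two (show 0 < 2 * n + 1 by omega), h,
    List.sum_cons]
  rcases Nat.mod_two_eq_zero_or_one (Nat.digits 2 n).sum with h | h <;>
    simp [Nat.add_mod, h]

/-- The image of a letter under the square of the Thue–Morse morphism. -/
def thueMorseBlock (b : Bool) : List Bool := [b, !b, !b, b]

theorem map_thueMorse_range_four_mul (k : ℕ) :
    (List.range (4 * k)).map thueMorse =
      ((List.range k).map thueMorse).flatMap thueMorseBlock := by
  induction k with
  | zero => rfl
  | succ k ih =>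
    have h0 : thueMorse (4 * k) = thueMorse k := by
      rw [show 4 * k = 2 * (2 * k) by ring, thueMorse_two_mul, thueMorse_two_mul]
    have h1 : thueMorse (4 * k + 1) = !thueMorse k := by
      rw [show 4 * k + 1 = 2 * (2 * k) + 1 by ring, thueMorse_two_mul_add_one, thueMorse_two_mul]
    have h2 : thueMorse (4 * k + 2) = !thueMorse k := by
      rw [show 4 * k + 2 = 2 * (2 * k + 1) by ring, thueMorse_two_mul, thueMorse_two_mul_add_one]
    have h3 : thueMorse (4 * k + 3) = thueMorse k := by
      rw [show 4 * k + 3 = 2 * (2 * k + 1) + 1 by ring, thueMorse_two_mul_add_one,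
        thueMorse_two_mul_add_one, Bool.not_not]
    simp [show 4 * (k + 1) = 4 * k + 1 + 1 + 1 + 1 by ring, List.range_succ, ih, h0, h1, h2, h3,
      thueMorseBlock]

theorem isShuffleSquare_flatMap_thueMorseBlock (a b c d : Bool) :
    IsShuffleSquare ([a, b, c, d].flatMap thueMorseBlock) :=
  isShuffleSquare_of_queueEmpties (by revert a b c d; decide +kernel)

/-- For every `k ≥ 3`, the prefix of length `4k` of the Thue–Morse word is a shuffle
square. -/
theorem statement18 (k : ℕ) (hk : 3 ≤ k) :
    IsShuffleSquare ((List.range (4 * k)).map thueMorse) := by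
  induction k using Nat.strong_induction_on with
  | _ k ih =>
    obtain hk' | hk' := Nat.lt_or_ge k 7
    · rw [map_thueMorse_range_four_mul]
      apply isShuffleSquare_of_queueEmpties
      interval_cases k <;> decide +kernel
    · obtain ⟨j, rfl⟩ := Nat.exists_eq_add_of_le' (show 4 ≤ k by omega)
      have h := (ih j (by omega) (by omega)).append
        (isShuffleSquare_flatMap_thueMorseBlock (thueMorse j) (thueMorse (j + 1))
          (thueMorse (j + 2)) (thueMorse (j + 3)))
      rw [map_thueMorse_range_four_mul] at h ⊢
      simpa [List.range_succ] using h
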